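/- arXiv:2012.07256 — 2 statements merged into one kernel-verified Lean document; each statement's English description precedes it below -/
import Mathlib

section
/- Let X be Borel distributed with parameter μ ∈ (0,1) and let M_X(τ) = E[e^{τX}] = Σ_{n≥1} e^{τn} e^{−μn}(μn)^{n−1}/n! be its moment generating function. Then for every real τ with τ < μ − 1 − log μ, the series defining M_X(τ) converges and log M_X(τ) = τ + μ (M_X(τ) − 1). -/
open Finset in
/-- A finite difference of order `n + 1` of the polynomial `x ↦ x ^ n`, expanded. -/
theorem sum_choose_succ_mul_pow_mul_neg_pow (n : ℕ) :
    ∑ k ∈ range (n + 1),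
      ((n + 1).choose (k + 1) : ℝ) * ((k : ℝ) + 1) ^ k * (-((k : ℝ) + 1)) ^ (n - k) =
      if n = 0 then 1 else 0 := by
  split_ifs with hn
  · subst hn; simp
  have h := congrFun (fwdDiff_iter_pow_eq_zero_of_lt (R := ℝ) (Nat.lt_succ_self n)) 0
  rw [fwdDiff_iter_eq_sum_shift, sum_range_succ'] at h
  simp only [zero_add, zero_smul, zero_pow hn, smul_zero, add_zero, Pi.zero_apply] at h
  rw [← h]
  refine sum_congr rfl fun k hk ↦ ?_
  have hkn : k ≤ n := Nat.lt_succ_iff.mp (mem_range.mp hk)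
  have hpow : ((k : ℝ) + 1) ^ n = ((k : ℝ) + 1) ^ k * ((k : ℝ) + 1) ^ (n - k) := by
    rw [← pow_add, Nat.add_sub_cancel' hkn]
  rw [neg_pow]
  simp only [nsmul_eq_mul, zsmul_eq_mul, Nat.succ_eq_add_one, Nat.add_sub_add_right]
  push_cast
  rw [mul_one, hpow]
  ring

theorem choose_succ_mul_choose_comm {m k j : ℕ} (h : k + j ≤ m) :
    (m + 1).choose (k + 1) * (m - k).choose j =
      (m + 1).choose j * (m - j + 1).choose (k + 1) := by
  have h₁ := Nat.choose_mul (n := m + 1) (k := k + 1 + j) (s := k + 1) (by lia)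
  have h₂ := Nat.choose_mul (n := m + 1) (k := k + 1 + j) (s := j) (by lia)
  rw [Nat.add_sub_cancel_left, Nat.add_sub_add_right] at h₁
  rw [Nat.add_sub_cancel, Nat.sub_add_comm (by lia : j ≤ m)] at h₂
  rw [← h₁, ← h₂, Nat.choose_symm_add]

open Finset in
/-- An instance of Abel's binomial identity. -/
theorem sum_choose_succ_mul_pow_mul_pow (m : ℕ) :
    ∑ k ∈ range (m + 1),
      ((m + 1).choose (k + 1) : ℝ) * ((k : ℝ) + 1) ^ k * ((m - k : ℕ) : ℝ) ^ (m - k) =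
      ((m : ℝ) + 1) ^ (m + 1) := by
  calc
    _ = ∑ k ∈ range (m + 1), ∑ j ∈ range (m - k + 1),
          ((m + 1).choose j : ℝ) * ((m : ℝ) + 1) ^ j *
            (((m - j + 1).choose (k + 1) : ℝ) * ((k : ℝ) + 1) ^ k *
              (-((k : ℝ) + 1)) ^ (m - j - k)) := by
      refine sum_congr rfl fun k hk ↦ ?_
      have hkm : k ≤ m := Nat.lt_succ_iff.mp (mem_range.mp hk)
      have hsub : ((m - k : ℕ) : ℝ) = ((m : ℝ) + 1) + -((k : ℝ) + 1) := by
        rw [Nat.cast_sub hkm]; ring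
      rw [hsub, add_pow ((m : ℝ) + 1) (-((k : ℝ) + 1)), mul_sum]
      refine sum_congr rfl fun j hj ↦ ?_
      have hj' : k + j ≤ m := by have := mem_range.mp hj; lia
      have hc : ((m + 1).choose (k + 1) : ℝ) * ((m - k).choose j : ℝ) =
          ((m + 1).choose j : ℝ) * ((m - j + 1).choose (k + 1) : ℝ) := by
        exact_mod_cast choose_succ_mul_choose_comm hj'
      rw [show m - j - k = m - k - j by lia]
      linear_combination ((k : ℝ) + 1) ^ k * ((m : ℝ) + 1) ^ j *
        (-((k : ℝ) + 1)) ^ (m - k - j) * hc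
    _ = ∑ j ∈ range (m + 1), ∑ k ∈ range (m - j + 1),
          ((m + 1).choose j : ℝ) * ((m : ℝ) + 1) ^ j *
            (((m - j + 1).choose (k + 1) : ℝ) * ((k : ℝ) + 1) ^ k *
              (-((k : ℝ) + 1)) ^ (m - j - k)) := by
      refine sum_comm' fun k j ↦ ?_
      simp only [mem_range]
      lia
    _ = ∑ j ∈ range (m + 1), ((m + 1).choose j : ℝ) * ((m : ℝ) + 1) ^ j *
          (if m - j = 0 then 1 else 0) := by
      refine sum_congr rfl fun j _ ↦ ?_
      rw [← mul_sum, sum_choose_succ_mul_pow_mul_neg_pow]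
    _ = _ := by
      rw [sum_range_succ, sum_eq_zero fun j hj ↦ ?_]
      · simp [pow_succ, mul_comm]
      · rw [if_neg (by have := mem_range.mp hj; lia), mul_zero]

/-- The coefficients `(n + 1) ^ n / (n + 1)!` of the tree function divided by its variable. -/
noncomputable def treeCoeff (n : ℕ) : ℝ := ((n : ℝ) + 1) ^ n / (n + 1).factorial

theorem treeCoeff_nonneg (n : ℕ) : 0 ≤ treeCoeff n := by
  unfold treeCoeff; positivity

theorem add_one_mul_treeCoeff_le (n : ℕ) : ((n : ℝ) + 1) * treeCoeff n ≤ Real.exp 1 ^ (n + 1) := by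
  have h := Real.pow_div_factorial_le_exp (x := (n : ℝ) + 1) (by positivity) (n + 1)
  calc ((n : ℝ) + 1) * treeCoeff n = ((n : ℝ) + 1) ^ (n + 1) / (n + 1).factorial := by
        rw [treeCoeff, pow_succ]; ring
    _ ≤ _ := h
    _ = _ := by rw [← Real.exp_nat_mul]; push_cast; rw [mul_one]

open Finset in
theorem sum_antidiagonal_treeCoeff (n : ℕ) :
    ∑ p ∈ antidiagonal n, treeCoeff p.1 * (((p.2 : ℝ) + 1) * treeCoeff p.2) =
      ((n : ℝ) + 1) * treeCoeff (n + 1) := by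
  have h := sum_choose_succ_mul_pow_mul_pow (n + 1)
  rw [sum_range_succ] at h
  rw [Nat.sum_antidiagonal_eq_sum_range_succ
    (fun i j ↦ treeCoeff i * (((j : ℝ) + 1) * treeCoeff j))]
  have hf : ((n + 2).factorial : ℝ) ≠ 0 := by positivity
  have key : ∀ k ∈ range (n + 1),
      treeCoeff k * ((((n - k : ℕ) : ℝ) + 1) * treeCoeff (n - k)) =
        (((n + 1 + 1).choose (k + 1) : ℝ) * ((k : ℝ) + 1) ^ k *
          ((n + 1 - k : ℕ) : ℝ) ^ (n + 1 - k)) / (n + 2).factorial := by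
    intro k hk
    have hkn : k ≤ n := Nat.lt_succ_iff.mp (mem_range.mp hk)
    have hc : ((n + 2).choose (k + 1) : ℝ) * (k + 1).factorial * (n - k + 1).factorial =
        (n + 2).factorial := by
      have := Nat.choose_mul_factorial_mul_factorial (n := n + 2) (k := k + 1) (by lia)
      rw [show n + 2 - (k + 1) = n - k + 1 by lia] at this
      exact_mod_cast this
    rw [show n + 1 - k = n - k + 1 by lia, treeCoeff, treeCoeff, ← hc]
    have hne : ((n + 2).choose (k + 1) : ℝ) ≠ 0 := by
      exact_mod_cast (Nat.choose_pos (by lia)).ne'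
    push_cast
    field_simp
    rw [pow_succ']
  rw [sum_congr rfl key, ← sum_div, treeCoeff]
  rw [div_eq_iff hf]
  push_cast at h ⊢
  simp only [Nat.sub_self, Nat.choose_self, Nat.cast_zero, pow_zero, Nat.cast_one, one_mul,
    mul_one] at h
  field_simp
  linear_combination h

theorem summable_add_one_mul_treeCoeff_mul_pow {y : ℝ} (hy : |y| < Real.exp (-1)) :
    Summable fun n : ℕ ↦ ‖((n : ℝ) + 1) * treeCoeff n * y ^ n‖ := by
  have hr : Real.exp 1 * |y| < 1 := by
    calc Real.exp 1 * |y| < Real.exp 1 * Real.exp (-1) := by gcongr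
      _ = 1 := by rw [← Real.exp_add]; simp
  refine .of_nonneg_of_le (fun _ ↦ norm_nonneg _) (fun n ↦ ?_)
    ((summable_geometric_of_lt_one (by positivity) hr).mul_left (Real.exp 1))
  have ha := treeCoeff_nonneg n
  rw [norm_mul, norm_pow, Real.norm_of_nonneg (by positivity), Real.norm_eq_abs, mul_pow,
    ← mul_assoc, ← pow_succ']
  gcongr
  exact add_one_mul_treeCoeff_le n

theorem summable_treeCoeff_mul_pow {y : ℝ} (hy : |y| < Real.exp (-1)) :
    Summable fun n : ℕ ↦ ‖treeCoeff n * y ^ n‖ := by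
  refine .of_nonneg_of_le (fun _ ↦ norm_nonneg _) (fun n ↦ ?_)
    (summable_add_one_mul_treeCoeff_mul_pow hy)
  rw [mul_assoc, norm_mul ((n : ℝ) + 1), Real.norm_of_nonneg (by positivity : (0 : ℝ) ≤ n + 1)]
  exact le_mul_of_one_le_left (norm_nonneg _) (by simp)

/-- The tree function divided by its variable. -/
noncomputable def treeSeries (y : ℝ) : ℝ := ∑' n : ℕ, treeCoeff n * y ^ n

theorem hasDerivAt_treeSeries {y : ℝ} (hy : |y| < Real.exp (-1)) :
    HasDerivAt treeSeries (∑' n : ℕ, treeCoeff n * (n * y ^ (n - 1))) y := by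
  obtain ⟨r, hyr, hr⟩ := exists_between hy
  have hr0 : 0 < r := (abs_nonneg y).trans_lt hyr
  have hr' : |r| < Real.exp (-1) := by rwa [abs_of_pos hr0]
  refine hasDerivAt_tsum_of_isPreconnected (t := Metric.ball (0 : ℝ) r) (y₀ := 0)
    (u := fun n : ℕ ↦ ‖((n : ℝ) + 1) * treeCoeff n * r ^ n‖ * r⁻¹)
    ((summable_add_one_mul_treeCoeff_mul_pow hr').mul_right _) Metric.isOpen_ball
    (convex_ball 0 r).isPreconnected
    (fun n z _ ↦ (hasDerivAt_pow n z).const_mul _) (fun n z hz ↦ ?_)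
    (Metric.mem_ball_self hr0) ?_ (by simpa using hyr)
  · have ha := treeCoeff_nonneg n
    have hz' : |z| ≤ r := by simpa using (Metric.mem_ball.mp hz).le
    rw [Real.norm_of_nonneg (by positivity : 0 ≤ ((n : ℝ) + 1) * treeCoeff n * r ^ n),
      norm_mul, norm_mul, norm_pow, Real.norm_of_nonneg ha, Real.norm_natCast, Real.norm_eq_abs]
    rcases n with _ | n
    · simp only [Nat.cast_zero, zero_mul, mul_zero]; positivity
    · calc treeCoeff (n + 1) * (((n + 1 : ℕ) : ℝ) * |z| ^ (n + 1 - 1))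
          ≤ treeCoeff (n + 1) * ((((n + 1 : ℕ) : ℝ) + 1) * r ^ n) := by
            rw [Nat.add_sub_cancel]; gcongr; linarith
        _ = _ := by rw [pow_succ]; field_simp
  · exact (summable_treeCoeff_mul_pow (y := 0) (by simpa using Real.exp_pos _)).of_norm

theorem hasDerivAt_treeSeries_eq {y : ℝ} (hy : |y| < Real.exp (-1)) :
    ∃ d, HasDerivAt treeSeries d y ∧ d = treeSeries y * (treeSeries y + y * d) := by
  refine ⟨_, hasDerivAt_treeSeries hy, ?_⟩
  have hs := (summable_treeCoeff_mul_pow hy).of_norm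
  have hs₁ := summable_add_one_mul_treeCoeff_mul_pow hy
  have hterm (n : ℕ) : y * (treeCoeff n * (n * y ^ (n - 1))) =
      ((n : ℝ) + 1) * treeCoeff n * y ^ n - treeCoeff n * y ^ n := by
    rcases n with _ | n
    · simp
    · rw [Nat.add_sub_cancel, pow_succ]; ring
  have hsum : treeSeries y + y * ∑' n : ℕ, treeCoeff n * (n * y ^ (n - 1)) =
      ∑' n : ℕ, ((n : ℝ) + 1) * treeCoeff n * y ^ n := by
    rw [← tsum_mul_left, tsum_congr hterm, hs₁.of_norm.tsum_sub hs, treeSeries]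
    ring
  rw [hsum, treeSeries, tsum_mul_tsum_eq_tsum_sum_antidiagonal_of_summable_norm
    (summable_treeCoeff_mul_pow hy) hs₁]
  have hcauchy (n : ℕ) : ∑ p ∈ Finset.HasAntidiagonal.antidiagonal n,
      treeCoeff p.1 * y ^ p.1 * (((p.2 : ℝ) + 1) * treeCoeff p.2 * y ^ p.2) =
      treeCoeff (n + 1) * ((n + 1 : ℕ) * y ^ (n + 1 - 1)) := by
    calc _ = (∑ p ∈ Finset.HasAntidiagonal.antidiagonal n,
          treeCoeff p.1 * (((p.2 : ℝ) + 1) * treeCoeff p.2)) * y ^ n := by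
          rw [Finset.sum_mul]
          refine Finset.sum_congr rfl fun p hp ↦ ?_
          rw [← Finset.HasAntidiagonal.mem_antidiagonal.mp hp, pow_add]
          ring
      _ = _ := by
          rw [sum_antidiagonal_treeCoeff, Nat.add_sub_cancel]
          push_cast
          ring
  rw [tsum_congr hcauchy]
  by_cases h : Summable fun n : ℕ ↦ treeCoeff n * (n * y ^ (n - 1))
  · rw [h.tsum_eq_zero_add]
    simp
  · rw [tsum_eq_zero_of_not_summable h, tsum_eq_zero_of_not_summable]
    exact fun h' ↦ h ((summable_nat_add_iff 1).mp h')

theorem treeSeries_zero : treeSeries 0 = 1 := by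
  rw [treeSeries, tsum_eq_single 0 fun n hn ↦ by simp [hn]]
  simp [treeCoeff]

/-- The functional equation `T = y * exp T` of the tree function `T = y * treeSeries y`. -/
theorem treeSeries_eq_exp {y : ℝ} (hy₀ : 0 ≤ y) (hy : y < Real.exp (-1)) :
    treeSeries y = Real.exp (y * treeSeries y) := by
  have hderiv : ∀ x ∈ Set.Icc 0 y,
      HasDerivAt (fun x ↦ treeSeries x * Real.exp (-(x * treeSeries x))) 0 x := by
    intro x hx
    obtain ⟨d, hd, hd_eq⟩ := hasDerivAt_treeSeries_eq (y := x)
      (by rw [abs_of_nonneg hx.1]; exact hx.2.trans_lt hy)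
    refine (hd.mul ((hasDerivAt_id x).mul hd).neg.exp).congr_deriv ?_
    simp only [Pi.mul_apply, Pi.neg_apply, id]
    linear_combination Real.exp (-(x * treeSeries x)) * hd_eq
  have hconst := constant_of_has_deriv_right_zero
    (fun x hx ↦ (hderiv x hx).continuousAt.continuousWithinAt)
    (fun x hx ↦ (hderiv x (Set.Ico_subset_Icc_self hx)).hasDerivWithinAt)
    y (Set.right_mem_Icc.mpr hy₀)
  simp only [treeSeries_zero, neg_zero, Real.exp_zero, mul_one] at hconst
  rwa [Real.exp_neg, mul_inv_eq_one₀ (Real.exp_ne_zero _)] at hconst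


/-- For a Borel distributed random variable with parameter `μ ∈ (0,1)` and
`τ < μ - 1 - log μ`, the series defining the moment generating function
`M_X(τ) = Σ_{n≥1} e^{τn} e^{-μn}(μn)^{n-1}/n!` converges, and
`log M_X(τ) = τ + μ (M_X(τ) - 1)`. -/
theorem borel_mgf_functional_equation (μ τ : ℝ) (hμ0 : 0 < μ) (hμ1 : μ < 1)
    (hτ : τ < μ - 1 - Real.log μ)
    (M : ℝ → ℝ)
    (hM : ∀ s : ℝ, M s =
      ∑' n : ℕ, Real.exp (s * (n + 1)) *
        (Real.exp (-μ * (n + 1)) * (μ * (n + 1)) ^ n / (n + 1).factorial)) :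
    Summable (fun n : ℕ => Real.exp (τ * (n + 1)) *
        (Real.exp (-μ * (n + 1)) * (μ * (n + 1)) ^ n / (n + 1).factorial)) ∧
    Real.log (M τ) = τ + μ * (M τ - 1) := by
  have hy : μ * Real.exp (τ - μ) < Real.exp (-1) := by
    rw [← Real.exp_log hμ0, ← Real.exp_add, Real.exp_log hμ0]
    exact Real.exp_lt_exp.mpr (by linarith)
  have hy₀ : 0 ≤ μ * Real.exp (τ - μ) := by positivity
  have hterm (n : ℕ) : Real.exp (τ * (n + 1)) *
      (Real.exp (-μ * (n + 1)) * (μ * (n + 1)) ^ n / (n + 1).factorial) =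
      Real.exp (τ - μ) * (treeCoeff n * (μ * Real.exp (τ - μ)) ^ n) := by
    have hexp : Real.exp (τ * (n + 1)) * Real.exp (-μ * (n + 1)) =
        Real.exp (τ - μ) * Real.exp (τ - μ) ^ n := by
      rw [← Real.exp_nat_mul, ← Real.exp_add, ← Real.exp_add]
      ring_nf
    rw [treeCoeff, mul_pow, mul_pow]
    linear_combination μ ^ n * ((n : ℝ) + 1) ^ n / (n + 1).factorial * hexp
  have hMτ : M τ = Real.exp (τ - μ) * treeSeries (μ * Real.exp (τ - μ)) := by
    rw [hM, tsum_congr hterm, tsum_mul_left, treeSeries]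
  refine ⟨?_, ?_⟩
  · simp_rw [hterm]
    exact (summable_treeCoeff_mul_pow (by rwa [abs_of_nonneg hy₀])).of_norm.mul_left _
  · have hlog : M τ = Real.exp (τ - μ + μ * M τ) := by
      rw [Real.exp_add, hMτ, ← mul_assoc μ, ← treeSeries_eq_exp hy₀ hy]
    calc Real.log (M τ) = τ - μ + μ * M τ := by
          conv_lhs => rw [hlog, Real.log_exp]
      _ = _ := by ring
end

section
/- Fix 0 < a < b and t > 0, and let κ⁽¹⁾(z) = (b/(b−a) − (a/(b−a)) e^{−(b−a)(t−z)}) · 1_{[0,t]}(z). Then for every z ∈ [0,t], the second Hawkes cumulant from a single point at z satisfies κ⁽²⁾(z) := Σ_{m=1}^∞ (Γᵐ (κ⁽¹⁾)²)(z) = (a b²/(b−a)³)(1 − e^{−(b−a)(t−z)}) − (2a²b/(b−a)²)(t−z) e^{−(b−a)(t−z)} − a³ (e^{−2(b−a)(t−z)} − e^{−(b−a)(t−z)})/(b−a)³. -/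
open MeasureTheory

/-- The integral operator `(Γf)(z) = a ∫₀^∞ f(z+y) e^{-by} dy`. -/
noncomputable def hawkesGamma (a b : ℝ) (f : ℝ → ℝ) : ℝ → ℝ :=
  fun z => a * ∫ y in Set.Ioi (0 : ℝ), f (z + y) * Real.exp (-b * y)

section HawkesGamma

variable {a b M : ℝ} {f g k : ℝ → ℝ}

lemma integrableOn_mul_exp_of_bounded (hb : 0 < b) (hf : Measurable f) (hM : ∀ z, |f z| ≤ M)
    (z : ℝ) : IntegrableOn (fun y => f (z + y) * Real.exp (-b * y)) (Set.Ioi 0) :=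
  (exp_neg_integrableOn_Ioi 0 hb).bdd_mul
    (hf.comp (measurable_const_add z)).aestronglyMeasurable (ae_of_all _ fun y => hM (z + y))

lemma hawkesGamma_add (hb : 0 < b) {N : ℝ} (hf : Measurable f) (hfM : ∀ z, |f z| ≤ M)
    (hg : Measurable g) (hgN : ∀ z, |g z| ≤ N) (z : ℝ) :
    hawkesGamma a b (fun w => f w + g w) z = hawkesGamma a b f z + hawkesGamma a b g z := by
  simp only [hawkesGamma, add_mul]
  rw [integral_add (integrableOn_mul_exp_of_bounded hb hf hfM z)
    (integrableOn_mul_exp_of_bounded hb hg hgN z), mul_add]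

lemma hawkesGamma_congr_of_nonneg (h : ∀ z, 0 ≤ z → f z = g z) {z : ℝ} (hz : 0 ≤ z) :
    hawkesGamma a b f z = hawkesGamma a b g z := by
  unfold hawkesGamma
  congr 1
  refine setIntegral_congr_fun measurableSet_Ioi fun y hy => ?_
  simp only [h (z + y) (add_nonneg hz (le_of_lt hy))]

lemma measurable_hawkesGamma (hf : Measurable f) : Measurable (hawkesGamma a b f) := by
  have h : StronglyMeasurable
      (Function.uncurry fun z y : ℝ => f (z + y) * Real.exp (-b * y)) := by
    apply Measurable.stronglyMeasurable
    unfold Function.uncurry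
    fun_prop
  exact (h.integral_prod_right (ν := volume.restrict (Set.Ioi 0))).measurable.const_mul a

lemma abs_hawkesGamma_le (ha : 0 ≤ a) (hb : 0 < b) (hM : ∀ z, |f z| ≤ M)
    (z : ℝ) : |hawkesGamma a b f z| ≤ a / b * M := by
  have hexp : ∫ y in Set.Ioi (0 : ℝ), Real.exp (-b * y) = 1 / b := by
    rw [integral_exp_mul_Ioi (neg_lt_zero.mpr hb)]
    simp
  have h : ‖∫ y in Set.Ioi (0 : ℝ), f (z + y) * Real.exp (-b * y)‖
      ≤ ∫ y in Set.Ioi (0 : ℝ), M * Real.exp (-b * y) := by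
    refine norm_integral_le_of_norm_le ((exp_neg_integrableOn_Ioi 0 hb).const_mul M)
      (ae_of_all _ fun y => ?_)
    rw [Real.norm_eq_abs, abs_mul, Real.abs_exp]
    gcongr
    exact hM _
  rw [integral_const_mul, hexp, Real.norm_eq_abs] at h
  rw [hawkesGamma, abs_mul, abs_of_nonneg ha]
  calc _ ≤ a * (M * (1 / b)) := by gcongr
    _ = a / b * M := by ring

lemma measurable_hawkesGamma_iterate (hf : Measurable f) (n : ℕ) :
    Measurable ((hawkesGamma a b)^[n] f) := by
  induction n with
  | zero => exact hf
  | succ n ih => rw [Function.iterate_succ_apply']; exact measurable_hawkesGamma ih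

lemma abs_hawkesGamma_iterate_le (ha : 0 ≤ a) (hb : 0 < b) (hM : ∀ z, |f z| ≤ M) (n : ℕ) :
    ∀ z, |(hawkesGamma a b)^[n] f z| ≤ (a / b) ^ n * M := by
  induction n with
  | zero => simpa using hM
  | succ n ih =>
    intro z
    rw [Function.iterate_succ_apply', pow_succ', mul_assoc]
    exact abs_hawkesGamma_le ha hb ih z

/-- The Neumann series of `hawkesGamma` solves the renewal equation `k = Γ f + Γ k`. -/
lemma hasSum_hawkesGamma_iterate (ha : 0 ≤ a) (hab : a < b) {N : ℝ}
    (hf : Measurable f) (hfM : ∀ z, |f z| ≤ M) (hk : Measurable k) (hkN : ∀ z, |k z| ≤ N)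
    (hrenew : ∀ z, 0 ≤ z → k z = hawkesGamma a b f z + hawkesGamma a b k z)
    {z : ℝ} (hz : 0 ≤ z) :
    HasSum (fun m : ℕ => (hawkesGamma a b)^[m + 1] f z) (k z) := by
  have hb : 0 < b := ha.trans_lt hab
  have hr0 : 0 ≤ a / b := by positivity
  have hr1 : a / b < 1 := (div_lt_one hb).mpr hab
  have hstep (n : ℕ) : ∀ z, 0 ≤ z → (hawkesGamma a b)^[n] k z
      = (hawkesGamma a b)^[n + 1] f z + (hawkesGamma a b)^[n + 1] k z := by
    induction n with
    | zero => exact hrenew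
    | succ n ih =>
      intro z hz
      rw [Function.iterate_succ_apply', hawkesGamma_congr_of_nonneg ih hz,
        hawkesGamma_add hb (measurable_hawkesGamma_iterate hf _)
          (abs_hawkesGamma_iterate_le ha hb hfM _) (measurable_hawkesGamma_iterate hk _)
          (abs_hawkesGamma_iterate_le ha hb hkN _),
        ← Function.iterate_succ_apply' (hawkesGamma a b),
        ← Function.iterate_succ_apply' (hawkesGamma a b)]
  have hpartial (n : ℕ) : ∑ m ∈ Finset.range n, (hawkesGamma a b)^[m + 1] f z
      = k z - (hawkesGamma a b)^[n] k z := by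
    induction n with
    | zero => simp
    | succ n ih => rw [Finset.sum_range_succ, ih, hstep n z hz]; ring
  have hsum : Summable fun m : ℕ => (hawkesGamma a b)^[m + 1] f z :=
    Summable.of_norm_bounded
      (((summable_nat_add_iff 1).mpr (summable_geometric_of_lt_one hr0 hr1)).mul_right M)
      fun m => abs_hawkesGamma_iterate_le ha hb hfM (m + 1) z
  rw [hsum.hasSum_iff_tendsto_nat]
  simp only [hpartial]
  have hzero : Filter.Tendsto (fun n => (hawkesGamma a b)^[n] k z) Filter.atTop (nhds 0) :=
    squeeze_zero_norm (fun n => abs_hawkesGamma_iterate_le ha hb hkN n z)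
      (by simpa using (tendsto_pow_atTop_nhds_zero_of_lt_one hr0 hr1).mul_const N)
  simpa using hzero.const_sub (k z)

lemma hawkesGamma_indicator_Icc (t : ℝ) {z : ℝ} (hz : z ∈ Set.Icc 0 t) :
    hawkesGamma a b ((Set.Icc 0 t).indicator f) z
      = a * ∫ y in (0 : ℝ)..(t - z), f (z + y) * Real.exp (-b * y) := by
  rw [hawkesGamma, intervalIntegral.integral_of_le (sub_nonneg.mpr hz.2), ← Set.Ioi_inter_Iic,
    ← setIntegral_indicator measurableSet_Iic]
  congr 1
  refine setIntegral_congr_fun measurableSet_Ioi fun y hy => ?_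
  have h : z + y ∈ Set.Icc 0 t ↔ y ∈ Set.Iic (t - z) := by
    have := hz.1
    simp only [Set.mem_Ioi, Set.mem_Icc, Set.mem_Iic] at *
    constructor
    · intro h; linarith [h.2]
    · intro h; constructor <;> linarith
  by_cases hy' : y ∈ Set.Iic (t - z)
  · simp only [Set.indicator_of_mem hy', Set.indicator_of_mem (h.mpr hy')]
  · simp only [Set.indicator_of_notMem hy', Set.indicator_of_notMem (mt h.mp hy'), zero_mul]

lemma hawkesGamma_indicator_Icc_of_lt {t z : ℝ} (hz : t < z) :
    hawkesGamma a b ((Set.Icc 0 t).indicator f) z = 0 := by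
  rw [hawkesGamma, setIntegral_eq_zero_of_forall_eq_zero, mul_zero]
  intro y hy
  rw [Set.indicator_of_notMem, zero_mul]
  intro h
  linarith [h.2, Set.mem_Ioi.mp hy]

/-- The differential form of the renewal equation on `[0, t]`. -/
lemma renewal_of_hasDerivAt {t : ℝ} (hg : Continuous g)
    (hk : ∀ z, HasDerivAt k ((b - a) * k z - a * g z) z) (hkt : k t = 0) {z : ℝ} (hz : 0 ≤ z) :
    (Set.Icc 0 t).indicator k z = hawkesGamma a b ((Set.Icc 0 t).indicator g) z
      + hawkesGamma a b ((Set.Icc 0 t).indicator k) z := by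
  rcases lt_or_ge t z with hzt | hzt
  · rw [hawkesGamma_indicator_Icc_of_lt hzt, hawkesGamma_indicator_Icc_of_lt hzt,
      Set.indicator_of_notMem fun h => absurd h.2 (not_le.mpr hzt), add_zero]
  have hkc : Continuous k := continuous_iff_continuousAt.mpr fun w => (hk w).continuousAt
  have hd (y : ℝ) : HasDerivAt (fun y => -(k (z + y) * Real.exp (-b * y)))
      (a * (g (z + y) * Real.exp (-b * y)) + a * (k (z + y) * Real.exp (-b * y))) y := by
    have h1 : HasDerivAt (fun y => k (z + y)) ((b - a) * k (z + y) - a * g (z + y)) y :=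
      (hk (z + y)).comp_const_add z y
    have h2 : HasDerivAt (fun y => Real.exp (-b * y)) (Real.exp (-b * y) * (-b * 1)) y :=
      ((hasDerivAt_id y).const_mul (-b)).exp
    exact (h1.mul h2).neg.congr_deriv (by ring)
  rw [hawkesGamma_indicator_Icc t ⟨hz, hzt⟩, hawkesGamma_indicator_Icc t ⟨hz, hzt⟩,
    Set.indicator_of_mem (Set.mem_Icc.mpr ⟨hz, hzt⟩), ← intervalIntegral.integral_const_mul,
    ← intervalIntegral.integral_const_mul, ← intervalIntegral.integral_add
      (Continuous.intervalIntegrable (by fun_prop) _ _)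
      (Continuous.intervalIntegrable (by fun_prop) _ _),
    intervalIntegral.integral_eq_sub_of_hasDerivAt (fun y _ => hd y)
      (Continuous.intervalIntegrable (by fun_prop) _ _)]
  simp [hkt]

lemma exists_abs_indicator_Icc_le (t : ℝ) (hf : Continuous f) :
    ∃ M, ∀ z, |(Set.Icc 0 t).indicator f z| ≤ M := by
  obtain ⟨M, hM⟩ := (isCompact_Icc (a := (0 : ℝ)) (b := t)).exists_bound_of_continuousOn
    hf.continuousOn
  refine ⟨|M|, fun z => ?_⟩
  by_cases hz : z ∈ Set.Icc 0 t
  · rw [Set.indicator_of_mem hz]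
    exact (hM z hz).trans (le_abs_self M)
  · simp [Set.indicator_of_notMem hz]

/-- The Neumann series of `hawkesGamma` applied to `g` restricted to `[0, t]` solves the
terminal value problem `k' = (b - a) k - a g`, `k t = 0`. -/
lemma hasSum_hawkesGamma_iterate_indicator (ha : 0 ≤ a) (hab : a < b) {t : ℝ} (hg : Continuous g)
    (hk : ∀ z, HasDerivAt k ((b - a) * k z - a * g z) z) (hkt : k t = 0)
    {z : ℝ} (hz : z ∈ Set.Icc 0 t) :
    HasSum (fun m : ℕ => (hawkesGamma a b)^[m + 1] ((Set.Icc 0 t).indicator g) z) (k z) := by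
  have hkc : Continuous k := continuous_iff_continuousAt.mpr fun w => (hk w).continuousAt
  obtain ⟨M, hM⟩ := exists_abs_indicator_Icc_le t hg
  obtain ⟨N, hN⟩ := exists_abs_indicator_Icc_le t hkc
  have h := hasSum_hawkesGamma_iterate ha hab (hg.measurable.indicator measurableSet_Icc) hM
    (hkc.measurable.indicator measurableSet_Icc) hN
    (fun w hw => renewal_of_hasDerivAt hg hk hkt hw) hz.1
  rwa [Set.indicator_of_mem hz] at h

end HawkesGamma

/-- For `0 < a < b` and `t > 0`, the second Hawkes cumulant from a single point at
`z ∈ [0,t]`, `κ⁽²⁾(z) = Σ_{m≥1} (Γᵐ (κ⁽¹⁾)²)(z)`, equals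
`(ab²/(b-a)³)(1 - e^{-(b-a)(t-z)}) - (2a²b/(b-a)²)(t-z)e^{-(b-a)(t-z)}
 - a³(e^{-2(b-a)(t-z)} - e^{-(b-a)(t-z)})/(b-a)³`. -/
theorem hawkes_second_cumulant (a b t : ℝ) (ha : 0 < a) (hab : a < b) (ht : 0 < t)
    (κ₁ κ₂ : ℝ → ℝ)
    (hκ₁ : κ₁ = Set.indicator (Set.Icc (0 : ℝ) t)
      (fun z => b / (b - a) - a / (b - a) * Real.exp (-(b - a) * (t - z))))
    (hκ₂ : ∀ z : ℝ, κ₂ z = ∑' m : ℕ, (hawkesGamma a b)^[m + 1] (fun w => (κ₁ w) ^ 2) z) :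
    ∀ z ∈ Set.Icc (0 : ℝ) t,
      κ₂ z = a * b ^ 2 / (b - a) ^ 3 * (1 - Real.exp (-(b - a) * (t - z)))
        - 2 * a ^ 2 * b / (b - a) ^ 2 * (t - z) * Real.exp (-(b - a) * (t - z))
        - a ^ 3 * (Real.exp (-2 * (b - a) * (t - z)) - Real.exp (-(b - a) * (t - z)))
            / (b - a) ^ 3 := by
  intro z hz
  have hc : b - a ≠ 0 := (sub_pos.mpr hab).ne'
  have hsq : (fun w => (κ₁ w) ^ 2) = (Set.Icc (0 : ℝ) t).indicator
      (fun z => (b / (b - a) - a / (b - a) * Real.exp (-(b - a) * (t - z))) ^ 2) := by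
    funext w
    rw [hκ₁]
    by_cases hw : w ∈ Set.Icc (0 : ℝ) t
    · simp only [Set.indicator_of_mem hw]
    · simp only [Set.indicator_of_notMem hw]
      norm_num
  rw [hκ₂, hsq]
  refine (hasSum_hawkesGamma_iterate_indicator (k := fun z =>
    a * b ^ 2 / (b - a) ^ 3 * (1 - Real.exp (-(b - a) * (t - z)))
      - 2 * a ^ 2 * b / (b - a) ^ 2 * (t - z) * Real.exp (-(b - a) * (t - z))
      - a ^ 3 * (Real.exp (-2 * (b - a) * (t - z)) - Real.exp (-(b - a) * (t - z)))
          / (b - a) ^ 3) ha.le hab (by fun_prop) (fun w => ?_) (by simp) hz).tsum_eq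
  have hs : HasDerivAt (fun z => t - z) (-1) w := (hasDerivAt_id w).const_sub t
  have hE := (hs.const_mul (-(b - a))).exp
  have hE2 := (hs.const_mul (-2 * (b - a))).exp
  have hexp : Real.exp (-2 * (b - a) * (t - w)) = Real.exp (-(b - a) * (t - w)) ^ 2 := by
    rw [← Real.exp_nat_mul]
    congr 1
    push_cast
    ring
  refine ((((hE.const_sub 1).const_mul (a * b ^ 2 / (b - a) ^ 3)).sub
    ((hs.const_mul (2 * a ^ 2 * b / (b - a) ^ 2)).mul hE)).sub
    (((hE2.sub hE).const_mul (a ^ 3)).div_const ((b - a) ^ 3))).congr_deriv ?_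
  rw [hexp]
  generalize Real.exp (-(b - a) * (t - w)) = E
  field_simp
  ring
end
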